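/- arXiv:2410.00418 — 3 statements merged into one kernel-verified Lean document; each statement's English description precedes it below -/
import Mathlib

section
/- Let X, Y be square-integrable random vectors, X̂* = E[X|Y], and let X̂' be an estimator whose joint distribution with X̂* equals that of (X, X̂*) (i.e. p_{X̂',X̂*} = p_{X,X̂*}) and which satisfies the Markov chain X → Y → X̂'. Then E[‖X − X̂'‖²] = 2·E[‖X − X̂*‖²], i.e. the MSE of X̂' equals twice the MMSE. -/
open MeasureTheory ProbabilityTheory

/-- The result for an arbitrary sub-σ-algebra. -/
theorem mse_aux {Ω : Type*} (m' : MeasurableSpace Ω) [mΩ : MeasurableSpace Ω]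
    [StandardBorelSpace Ω] (hle : m' ≤ mΩ)
    (μ : Measure Ω) [IsProbabilityMeasure μ] {n : ℕ}
    (X Xhat' : Ω → EuclideanSpace ℝ (Fin n))
    (hX : Measurable X) (hXhat' : Measurable Xhat')
    (hX2 : Integrable (fun ω => ‖X ω‖ ^ 2) μ)
    (hXhat'2 : Integrable (fun ω => ‖Xhat' ω‖ ^ 2) μ)
    (hjoint : Measure.map (fun ω => (Xhat' ω, (μ[X | m']) ω)) μ
        = Measure.map (fun ω => (X ω, (μ[X | m']) ω)) μ)
    (hMarkov : CondIndepFun m' hle X Xhat' μ) :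
    ∫ ω, ‖X ω - Xhat' ω‖ ^ 2 ∂μ = 2 * ∫ ω, ‖X ω - (μ[X | m']) ω‖ ^ 2 ∂μ := by
  set M := μ[X | m'] with hM
  have X2 : MemLp X 2 μ := (memLp_two_iff_integrable_sq_norm hX.aestronglyMeasurable).2 hX2
  have Z2 : MemLp Xhat' 2 μ :=
    (memLp_two_iff_integrable_sq_norm hXhat'.aestronglyMeasurable).2 hXhat'2
  have M2 : MemLp M 2 μ := X2.condExp one_le_two
  have hMm : StronglyMeasurable[m'] M := stronglyMeasurable_condExp
  have hMmeas : Measurable M := (hMm.mono hle).measurable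
  have inn : ∀ {f g : Ω → EuclideanSpace ℝ (Fin n)}, MemLp f 2 μ → MemLp g 2 μ →
      Integrable (fun ω => innerSL ℝ (f ω) (g ω)) μ := by
    intro f g hf hg
    have := (hf.norm).integrable_mul hg.norm
    refine this.mono' ?_ (Filter.Eventually.of_forall fun ω => ?_)
    · exact hf.1.inner hg.1
    · exact norm_inner_le_norm (𝕜 := ℝ) (f ω) (g ω)
  have X1 : Integrable X μ := X2.integrable one_le_two
  have Z1 : Integrable Xhat' μ := Z2.integrable one_le_two
  have hA : ∫ ω, innerSL ℝ (X ω) (Xhat' ω) ∂μ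
      = ∫ ω, innerSL ℝ (M ω) ((μ[Xhat' | m']) ω) ∂μ := by
    rw [← integral_condExp hle]
    refine integral_congr_ae ?_
    have h1 := (condIndepFun_iff_map_prod_eq_prod_map_map hX hXhat').1 hMarkov
    have h1 := ae_of_ae_trim hle h1
    filter_upwards [h1, condExp_ae_eq_integral_condExpKernel hle X1,
      condExp_ae_eq_integral_condExpKernel hle Z1,
      condExp_ae_eq_integral_condExpKernel hle (inn X2 Z2), X1.condExpKernel_ae (m := m'),
      Z1.condExpKernel_ae (m := m')] with ω h1 h2 h3 h4 h5 h6
    rw [h4, hM, h2, h3]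
    have hind : IndepFun X Xhat' (condExpKernel μ m' ω) := by
      rw [indepFun_iff_map_prod_eq_prod_map_map hX.aemeasurable hXhat'.aemeasurable]
      rw [Kernel.prod_apply, Kernel.map_apply _ hX, Kernel.map_apply _ hXhat',
        Kernel.map_apply _ (hX.prodMk hXhat')] at h1
      exact h1
    exact hind.integral_bilin h5 h6 (innerSL ℝ)
  have hB : ∫ ω, innerSL ℝ (M ω) (Xhat' ω) ∂μ
      = ∫ ω, innerSL ℝ (M ω) ((μ[Xhat' | m']) ω) ∂μ := by
    rw [← integral_condExp hle]
    exact integral_congr_ae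
      (condExp_bilin_of_stronglyMeasurable_left (innerSL ℝ) hMm (inn M2 Z2) Z1)
  have hC : ∫ ω, innerSL ℝ (X ω) (M ω) ∂μ = ∫ ω, innerSL ℝ (M ω) (M ω) ∂μ := by
    rw [← integral_condExp hle]
    exact integral_congr_ae
      (condExp_bilin_of_stronglyMeasurable_right (innerSL ℝ) hMm (inn X2 M2) X1)
  have hD : ∫ ω, ‖Xhat' ω - M ω‖ ^ 2 ∂μ = ∫ ω, ‖X ω - M ω‖ ^ 2 ∂μ := by
    have hf : Measurable fun p : EuclideanSpace ℝ (Fin n) × EuclideanSpace ℝ (Fin n) =>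
      ‖p.1 - p.2‖ ^ 2 := by fun_prop
    have e1 := integral_map (hXhat'.prodMk hMmeas).aemeasurable
      (hf.aestronglyMeasurable (μ := μ.map fun ω => (Xhat' ω, M ω)))
    have e2 := integral_map (hX.prodMk hMmeas).aemeasurable
      (hf.aestronglyMeasurable (μ := μ.map fun ω => (X ω, M ω)))
    rw [hjoint] at e1
    exact e1.symm.trans e2
  have key : ∀ ω, ‖X ω - Xhat' ω‖ ^ 2 = (‖X ω - M ω‖ ^ 2 + ‖Xhat' ω - M ω‖ ^ 2)
      - 2 * ((innerSL ℝ (X ω) (Xhat' ω) - innerSL ℝ (M ω) (Xhat' ω))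
        - (innerSL ℝ (X ω) (M ω) - innerSL ℝ (M ω) (M ω))) := by
    intro ω
    have : X ω - Xhat' ω = (X ω - M ω) - (Xhat' ω - M ω) := by abel
    rw [this, norm_sub_sq_real]
    simp only [innerSL_apply_apply, inner_sub_left, inner_sub_right]
    ring
  have sq : ∀ {f : Ω → EuclideanSpace ℝ (Fin n)}, MemLp f 2 μ →
      Integrable (fun ω => ‖f ω‖ ^ 2) μ := fun hf =>
    (memLp_two_iff_integrable_sq_norm hf.1).1 hf
  have i1 : Integrable (fun ω => ‖X ω - M ω‖ ^ 2) μ := sq (X2.sub M2)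
  have i2 : Integrable (fun ω => ‖Xhat' ω - M ω‖ ^ 2) μ := sq (Z2.sub M2)
  have j1 : Integrable (fun ω => innerSL ℝ (X ω) (Xhat' ω) - innerSL ℝ (M ω) (Xhat' ω)) μ :=
    (inn X2 Z2).sub (inn M2 Z2)
  have j2 : Integrable (fun ω => innerSL ℝ (X ω) (M ω) - innerSL ℝ (M ω) (M ω)) μ :=
    (inn X2 M2).sub (inn M2 M2)
  have i3 : Integrable (fun ω => ‖X ω - M ω‖ ^ 2 + ‖Xhat' ω - M ω‖ ^ 2) μ := i1.add i2
  have j3 : Integrable (fun ω => 2 *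
      ((innerSL ℝ (X ω) (Xhat' ω) - innerSL ℝ (M ω) (Xhat' ω))
        - (innerSL ℝ (X ω) (M ω) - innerSL ℝ (M ω) (M ω)))) μ := (j1.sub j2).const_mul 2
  simp_rw [key]
  rw [integral_sub i3 j3, integral_add i1 i2, integral_const_mul,
    integral_sub j1 j2, integral_sub (inn X2 Z2) (inn M2 Z2), integral_sub (inn X2 M2) (inn M2 M2),
    hA, hB, hC, hD]
  ring

/-- If `X̂'` satisfies the Markov chain `X → Y → X̂'` and `(X̂', X̂*)` has the same joint
distribution as `(X, X̂*)`, then the MSE of `X̂'` equals twice the MMSE. -/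
theorem mse_of_sampler_conditioned_on_posterior_mean
    {Ω : Type*} [MeasurableSpace Ω] [StandardBorelSpace Ω]
    (μ : Measure Ω) [IsProbabilityMeasure μ] {n m : ℕ}
    (X : Ω → EuclideanSpace ℝ (Fin n)) (Y : Ω → EuclideanSpace ℝ (Fin m))
    (Xhat' : Ω → EuclideanSpace ℝ (Fin n))
    (hX : Measurable X) (hY : Measurable Y) (hXhat' : Measurable Xhat')
    (hX2 : Integrable (fun ω => ‖X ω‖ ^ 2) μ)
    (hXhat'2 : Integrable (fun ω => ‖Xhat' ω‖ ^ 2) μ)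
    (hjoint :
      Measure.map (fun ω => (Xhat' ω, (μ[X | MeasurableSpace.comap Y inferInstance]) ω)) μ
        = Measure.map (fun ω => (X ω, (μ[X | MeasurableSpace.comap Y inferInstance]) ω)) μ)
    (hMarkov : CondIndepFun (MeasurableSpace.comap Y inferInstance) hY.comap_le X Xhat' μ) :
    ∫ ω, ‖X ω - Xhat' ω‖ ^ 2 ∂μ
      = 2 * ∫ ω, ‖X ω - (μ[X | MeasurableSpace.comap Y inferInstance]) ω‖ ^ 2 ∂μ := by
  exact mse_aux _ hY.comap_le μ X Xhat' hX hXhat' hX2 hXhat'2 hjoint hMarkov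
end

section
/- Let Ẑ_t solve the ODE dẐ_t = v(Ẑ_t,t)dt on [0,1] with Ẑ_0 = X̂* = E[X|Y], where v(z,t) = E[X − X̂* | Z_t = z] and Z_t = tX + (1−t)X̂*. Assume the ODE solution exists, is unique, and the marginal distributions satisfy p_{Ẑ_t} = p_{Z_t} for all t. Then E[‖Ẑ_1 − X̂*‖²] ≤ E[‖X − X̂*‖²]. -/
open MeasureTheory ProbabilityTheory

lemma ae_map_of_ae_comp {Ω E : Type*} [mΩ : MeasurableSpace Ω] [StandardBorelSpace Ω]
    [TopologicalSpace E] [T2Space E] [SecondCountableTopology E] [MeasurableSpace E] [BorelSpace E]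
    (μ : Measure Ω) [IsFiniteMeasure μ] (f : Ω → E) (hf : Measurable f) (p : E → Prop)
    (h : ∀ᵐ ω ∂μ, p (f ω)) : ∀ᵐ z ∂(μ.map f), p z := by
  let := upgradeStandardBorel Ω
  let tΩ : TopologicalSpace Ω := inferInstance
  obtain ⟨t', t't, f_cont, t'_polish⟩ :
      ∃ t' : TopologicalSpace Ω, t' ≤ tΩ ∧ @Continuous Ω _ t' _ f ∧ @PolishSpace Ω t' :=
    hf.exists_continuous
  have hb : @borel Ω t' = mΩ := by
    rw [eq_borel_upgradeStandardBorel Ω]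
    exact borel_eq_borel_of_le t'_polish inferInstance t't
  have hB : @BorelSpace Ω t' mΩ := @BorelSpace.mk _ t' mΩ hb.symm
  have key : ∀ A : Set Ω, MeasurableSet A → ∀ ε : ENNReal, ε ≠ 0 → 
      ∃ K ⊆ A, (@IsCompact Ω t' K ∧ MeasurableSet K) ∧ μ A < μ K + ε := by
    clear * - hB t'_polish
    intro A hA ε hε
    let := t'
    obtain ⟨K, h1, h2, h3⟩ := hA.exists_isCompact_lt_add (measure_ne_top μ _) hε
    exact ⟨K, h1, ⟨h2, h2.measurableSet⟩, h3⟩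
  obtain ⟨B, hBs, hBm, hB0⟩ := exists_measurable_superset_of_null (ae_iff.1 h)
  rw [ae_iff]
  refine le_antisymm (ENNReal.le_of_forall_pos_le_add fun ε hε _ => ?_) bot_le
  obtain ⟨K, hKB, ⟨hK, hKm⟩, hlt⟩ := key Bᶜ hBm.compl ε (by simpa using hε.ne')
  have hfK : IsCompact (f '' K) := @IsCompact.image _ _ t' _ _ _ hK f_cont
  have hm : MeasurableSet (f '' K)ᶜ := hfK.measurableSet.compl
  have hsub : {a | ¬ p a} ⊆ (f '' K)ᶜ := by
    rintro a ha ⟨ω, hω, rfl⟩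
    exact hKB hω (hBs ha)
  calc μ.map f {a | ¬ p a} ≤ μ.map f (f '' K)ᶜ := measure_mono hsub
    _ = μ (f ⁻¹' (f '' K)ᶜ) := Measure.map_apply hf hm
    _ ≤ μ Kᶜ := measure_mono (by
        intro ω hω hk; exact hω ⟨ω, hk, rfl⟩)
    _ ≤ 0 + ε := by
        rw [measure_compl hKm (measure_ne_top _ _)]
        rw [measure_compl hBm (measure_ne_top _ _), hB0, tsub_zero] at hlt
        rw [zero_add]
        exact tsub_le_iff_left.2 hlt.le

/-- a straddling difference quotient converges to the derivative -/
lemma tendsto_straddle {E : Type*} [NormedAddCommGroup E] [NormedSpace ℝ E]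
    (f : ℝ → E) (f' : E) (t : ℝ) (h : HasDerivAt f f' t) :
    Filter.Tendsto (fun k : ℕ => ((k : ℝ) + 1) •
      (f (((⌊t * (k + 1)⌋ : ℤ) + 1 : ℝ) / (k + 1)) - f ((⌊t * (k + 1)⌋ : ℤ) / (k + 1) : ℝ)))
      Filter.atTop (nhds f') := by
  rw [Metric.tendsto_atTop]
  intro ε hε
  have h1 := (hasDerivAt_iff_isLittleO.1 h).def (c := ε / 4) (by positivity)
  obtain ⟨δ, hδ, h2⟩ := Metric.eventually_nhds_iff.1 h1
  obtain ⟨N, hN⟩ := exists_nat_gt (1 / δ)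
  refine ⟨N, fun k hk => ?_⟩
  have hk' : (N : ℝ) ≤ k := by exact_mod_cast hk
  have hkp : (0 : ℝ) < k + 1 := by positivity
  set a : ℝ := (⌊t * (k + 1)⌋ : ℤ) / (k + 1) with ha
  set b : ℝ := ((⌊t * (k + 1)⌋ : ℤ) + 1 : ℝ) / (k + 1) with hb
  have hab : b - a = 1 / (k + 1) := by rw [ha, hb]; field_simp; ring
  have hat : a ≤ t := by rw [ha, div_le_iff₀ hkp]; exact Int.floor_le _
  have htb : t ≤ b := by rw [hb, le_div_iff₀ hkp]; exact (Int.lt_floor_add_one _).le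
  have hs : 1 / ((k : ℝ) + 1) < δ := by
    rw [div_lt_comm₀ hkp hδ]; linarith
  have ea := h2 (y := a) (by rw [Real.dist_eq, abs_lt]; constructor <;> linarith)
  have eb := h2 (y := b) (by rw [Real.dist_eq, abs_lt]; constructor <;> linarith)
  have na : ‖a - t‖ ≤ 1 / (k + 1) := by rw [Real.norm_eq_abs, abs_le]; constructor <;> linarith
  have nb : ‖b - t‖ ≤ 1 / (k + 1) := by rw [Real.norm_eq_abs, abs_le]; constructor <;> linarith
  have e : ((k : ℝ) + 1) • (f b - f a) - f' =
      ((k : ℝ) + 1) • ((f b - f t - (b - t) • f') - (f a - f t - (a - t) • f')) := by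
    have : f b - f t - (b - t) • f' - (f a - f t - (a - t) • f') = (f b - f a) - (b - a) • f' := by
      module
    rw [this, hab, smul_sub ((k:ℝ)+1) (f b - f a), smul_smul, mul_one_div_cancel hkp.ne', one_smul]
  rw [dist_eq_norm, e, norm_smul, Real.norm_of_nonneg hkp.le]
  have : ‖(f b - f t - (b - t) • f') - (f a - f t - (a - t) • f')‖ ≤ ε / 2 * (1 / (k + 1)) := by
    refine (norm_sub_le _ _).trans ?_
    nlinarith
  calc _ ≤ ((k:ℝ) + 1) * (ε / 2 * (1 / (k + 1))) := by gcongr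
    _ = ε / 2 := by field_simp
    _ < ε := by linarith

/-- Jensen in time. -/
lemma enorm_sub_sq_le {E : Type*} [NormedAddCommGroup E] [NormedSpace ℝ E] [CompleteSpace E]
    [SecondCountableTopology E] [MeasurableSpace E] [BorelSpace E]
    (f f' : ℝ → E) (h : ∀ t ∈ Set.Icc (0:ℝ) 1, HasDerivAt f (f' t) t) :
    ‖f 1 - f 0‖ₑ ^ 2 ≤ ∫⁻ t in Set.Ioc (0:ℝ) 1, ‖f' t‖ₑ ^ 2 := by
  by_cases hfin : ∫⁻ t in Set.Ioc (0:ℝ) 1, ‖f' t‖ₑ ^ 2 = ⊤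
  · rw [hfin]; exact le_top
  have hprob : IsProbabilityMeasure (volume.restrict (Set.Ioc (0:ℝ) 1)) := ⟨by simp⟩
  have hm : AEStronglyMeasurable f' (volume.restrict (Set.Ioc (0:ℝ) 1)) := by
    refine (stronglyMeasurable_deriv f).aestronglyMeasurable.congr ?_
    filter_upwards [ae_restrict_mem measurableSet_Ioc] with t ht
    exact (h t ⟨ht.1.le, ht.2⟩).deriv
  have e2 : eLpNorm f' 2 (volume.restrict (Set.Ioc (0:ℝ) 1)) ^ 2
      = ∫⁻ t in Set.Ioc (0:ℝ) 1, ‖f' t‖ₑ ^ 2 := by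
    have := eLpNorm_nnreal_pow_eq_lintegral (f := f') (p := 2)
      (μ := volume.restrict (Set.Ioc (0:ℝ) 1)) two_ne_zero
    simpa using this
  have hL : MemLp f' 2 (volume.restrict (Set.Ioc (0:ℝ) 1)) := by
    refine ⟨hm, lt_top_iff_ne_top.2 fun ht => hfin ?_⟩
    rw [← e2, ht]; simp
  have hi : IntervalIntegrable f' volume 0 1 := by
    rw [intervalIntegrable_iff_integrableOn_Ioc_of_le zero_le_one]
    exact hL.integrable one_le_two
  have := intervalIntegral.integral_eq_sub_of_hasDerivAt (f := f) (f' := f') (a := 0) (b := 1)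
    (by rw [Set.uIcc_of_le zero_le_one]; exact h) hi
  rw [← this, intervalIntegral.integral_of_le zero_le_one, ← e2]
  gcongr
  refine (enorm_integral_le_lintegral_enorm _).trans ?_
  rw [← eLpNorm_one_eq_lintegral_enorm]
  exact eLpNorm_le_eLpNorm_of_exponent_le one_le_two hm

/-- joint measurability of the derivative. -/
lemma aemeasurable_deriv_uncurry {Ω E : Type*} [MeasurableSpace Ω]
    (μ : Measure Ω) [IsFiniteMeasure μ]
    [NormedAddCommGroup E] [NormedSpace ℝ E]
    [SecondCountableTopology E] [MeasurableSpace E] [BorelSpace E]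
    (Z Z' : ℝ → Ω → E) (hZ : ∀ t ∈ Set.Icc (0:ℝ) 1, AEMeasurable (Z t) μ)
    (h : ∀ ω, ∀ t ∈ Set.Icc (0:ℝ) 1, HasDerivAt (fun s => Z s ω) (Z' t ω) t) :
    AEMeasurable (fun q : Ω × ℝ => Z' q.2 q.1) (μ.prod (volume.restrict (Set.Ioc (0:ℝ) 1))) := by
  classical
  let W : ℝ → Ω → E := fun t => if ht : t ∈ Set.Icc (0:ℝ) 1 then (hZ t ht).mk (Z t) else 0
  have hW : ∀ t, Measurable (W t) := by
    intro t
    by_cases ht : t ∈ Set.Icc (0:ℝ) 1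
    · simp only [W, dif_pos ht]; exact (hZ t ht).measurable_mk
    · simp only [W, dif_neg ht]; exact measurable_const
  have hWZ : ∀ t ∈ Set.Icc (0:ℝ) 1, Z t =ᵐ[μ] W t := by
    intro t ht
    simp only [W, dif_pos ht]; exact (hZ t ht).ae_eq_mk
  have hall : ∀ᵐ ω ∂μ, ∀ (k : ℕ) (j : ℤ), ((j : ℝ) / (k + 1)) ∈ Set.Icc (0:ℝ) 1 →
      Z ((j : ℝ) / (k + 1)) ω = W ((j : ℝ) / (k + 1)) ω := by
    rw [ae_all_iff]; intro k
    rw [ae_all_iff]; intro j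
    by_cases ht : ((j : ℝ) / (k + 1)) ∈ Set.Icc (0:ℝ) 1
    · filter_upwards [hWZ _ ht] with ω hω _ using hω
    · exact Filter.Eventually.of_forall fun ω h => absurd h ht
  let G : ℕ → Ω × ℝ → E := fun k q => ((k : ℝ) + 1) •
      (W (((⌊q.2 * (k + 1)⌋ + 1 : ℤ) : ℝ) / (k + 1)) q.1 - W ((⌊q.2 * (k + 1)⌋ : ℤ) / (k + 1) : ℝ) q.1)
  have hG : ∀ k, Measurable (G k) := by
    intro k
    let H : Ω × ℤ → E := fun q => ((k : ℝ) + 1) •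
      (W (((q.2 + 1 : ℤ) : ℝ) / (k + 1)) q.1 - W ((q.2 : ℤ) / (k + 1) : ℝ) q.1)
    have hH : Measurable H := by
      refine measurable_from_prod_countable_left fun j => ?_
      have := ((hW (((j + 1 : ℤ) : ℝ) / (k + 1))).sub (hW ((j : ℤ) / (k + 1) : ℝ))).const_smul
        ((k : ℝ) + 1)
      exact this
    have : G k = H ∘ fun q : Ω × ℝ => (q.1, ⌊q.2 * (k + 1)⌋) := rfl
    rw [this]
    exact hH.comp (measurable_fst.prodMk (Int.measurable_floor.comp (measurable_snd.mul_const _)))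
  refine aemeasurable_of_tendsto_metrizable_ae Filter.atTop (f := G) (fun k => (hG k).aemeasurable) ?_
  have h1 : ∀ᵐ q ∂(μ.prod (volume.restrict (Set.Ioc (0:ℝ) 1))), ∀ (k : ℕ) (j : ℤ),
      ((j : ℝ) / (k + 1)) ∈ Set.Icc (0:ℝ) 1 →
      Z ((j : ℝ) / (k + 1)) q.1 = W ((j : ℝ) / (k + 1)) q.1 :=
    Measure.quasiMeasurePreserving_fst.ae hall
  have h0 : ∀ᵐ t ∂(volume.restrict (Set.Ioc (0:ℝ) 1)), t ∈ Set.Ioo (0:ℝ) 1 := by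
    rw [← restrict_Ioo_eq_restrict_Ioc]
    exact ae_restrict_mem measurableSet_Ioo
  have h2 : ∀ᵐ q ∂(μ.prod (volume.restrict (Set.Ioc (0:ℝ) 1))), q.2 ∈ Set.Ioo (0:ℝ) 1 :=
    Measure.quasiMeasurePreserving_snd.ae h0
  filter_upwards [h1, h2] with q hq1 hq2
  have ht := tendsto_straddle _ _ _ (h q.1 q.2 ⟨hq2.1.le, hq2.2.le⟩)
  refine ht.congr fun k => ?_
  have hkp : (0 : ℝ) < k + 1 := by positivity
  have hf0 : 0 ≤ ⌊q.2 * ((k:ℝ) + 1)⌋ := Int.floor_nonneg.2 (by have := hq2.1; positivity)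
  have hf1 : ⌊q.2 * ((k:ℝ) + 1)⌋ + 1 ≤ (k : ℤ) + 1 := by
    have : ⌊q.2 * ((k:ℝ) + 1)⌋ < (k : ℤ) + 1 := by
      rw [Int.floor_lt]; push_cast
      have := hq2.2
      nlinarith
    omega
  have hf0' : (0:ℝ) ≤ (⌊q.2 * ((k:ℝ) + 1)⌋ : ℤ) := by exact_mod_cast hf0
  have hf1' : ((⌊q.2 * ((k:ℝ) + 1)⌋ : ℤ) : ℝ) + 1 ≤ (k : ℝ) + 1 := by exact_mod_cast hf1
  have ea := hq1 k ⌊q.2 * ((k:ℝ) + 1)⌋ ⟨by positivity, by rw [div_le_one hkp]; linarith⟩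
  have eb := hq1 k (⌊q.2 * ((k:ℝ) + 1)⌋ + 1) ⟨by push_cast; positivity,
    by rw [div_le_one hkp]; push_cast; linarith⟩
  simp only [G]
  rw [← ea, ← eb]
  push_cast
  rfl

/-- PMRF with `σ_s = 0`: if `Ẑ_t` is the unique solution of `dẐ_t = v(Ẑ_t,t)dt` started
from `Ẑ_0 = X̂*`, where `v(z,t) = E[X − X̂* | Z_t = z]`, `Z_t = tX + (1−t)X̂*`, and the
marginals are preserved (`p_{Ẑ_t} = p_{Z_t}`), then `E‖Ẑ_1 − X̂*‖² ≤ E‖X − X̂*‖²`. -/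
theorem pmrf_transport_cost_bound
    {Ω : Type*} [MeasurableSpace Ω] [StandardBorelSpace Ω]
    (μ : Measure Ω) [IsProbabilityMeasure μ] {n m : ℕ}
    (X : Ω → EuclideanSpace ℝ (Fin n)) (Y : Ω → EuclideanSpace ℝ (Fin m))
    (hX : Measurable X) (hY : Measurable Y)
    (hX2 : Integrable (fun ω => ‖X ω‖ ^ 2) μ)
    (Xs : Ω → EuclideanSpace ℝ (Fin n))
    (hXs : Xs = μ[X | MeasurableSpace.comap Y inferInstance])
    (v : EuclideanSpace ℝ (Fin n) → ℝ → EuclideanSpace ℝ (Fin n))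
    (hv : ∀ t : ℝ,
      (fun ω => v (t • X ω + (1 - t) • Xs ω) t)
        =ᵐ[μ] μ[(fun ω => X ω - Xs ω) |
          MeasurableSpace.comap (fun ω => t • X ω + (1 - t) • Xs ω) inferInstance])
    (Zhat : ℝ → Ω → EuclideanSpace ℝ (Fin n))
    (hinit : Zhat 0 = Xs)
    (hode : ∀ ω, ∀ t ∈ Set.Icc (0 : ℝ) 1,
      HasDerivAt (fun s => Zhat s ω) (v (Zhat t ω) t) t)
    (huniq : ∀ Z' : ℝ → Ω → EuclideanSpace ℝ (Fin n), Z' 0 = Xs →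
      (∀ ω, ∀ t ∈ Set.Icc (0 : ℝ) 1,
        HasDerivAt (fun s => Z' s ω) (v (Z' t ω) t) t) →
      ∀ t ∈ Set.Icc (0 : ℝ) 1, ∀ ω, Z' t ω = Zhat t ω)
    (hmarg : ∀ t ∈ Set.Icc (0 : ℝ) 1,
      Measure.map (Zhat t) μ = Measure.map (fun ω => t • X ω + (1 - t) • Xs ω) μ) :
    ∫ ω, ‖Zhat 1 ω - Xs ω‖ ^ 2 ∂μ ≤ ∫ ω, ‖X ω - Xs ω‖ ^ 2 ∂μ := by
  have hXL : MemLp X 2 μ := (memLp_two_iff_integrable_sq_norm hX.aestronglyMeasurable).2 hX2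
  have hXsL : MemLp Xs 2 μ := by rw [hXs]; exact hXL.condExp one_le_two
  have hXsm : Measurable Xs := by
    rw [hXs]
    exact (stronglyMeasurable_condExp.mono hY.comap_le).measurable
  have hD : MemLp (fun ω => X ω - Xs ω) 2 μ := hXL.sub hXsL
  have sqe : ∀ f : Ω → EuclideanSpace ℝ (Fin n), eLpNorm f 2 μ ^ 2 = ∫⁻ ω, ‖f ω‖ₑ ^ 2 ∂μ := by
    intro f
    have := eLpNorm_nnreal_pow_eq_lintegral (f := f) (p := 2) (μ := μ) two_ne_zero
    simpa using this
  have hZt : ∀ t : ℝ, Measurable (fun ω => t • X ω + (1 - t) • Xs ω) := fun t =>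
    (hX.const_smul t).add (hXsm.const_smul (1 - t))
  have hZm : ∀ t ∈ Set.Icc (0 : ℝ) 1, AEMeasurable (Zhat t) μ := by
    intro t ht
    apply AEMeasurable.of_map_ne_zero
    rw [hmarg t ht]
    have := Measure.isProbabilityMeasure_map (μ := μ) (hZt t).aemeasurable
    exact IsProbabilityMeasure.ne_zero _
  -- second moment of the velocity at each time
  have hvel : ∀ t ∈ Set.Icc (0 : ℝ) 1,
      ∫⁻ ω, ‖v (Zhat t ω) t‖ₑ ^ 2 ∂μ ≤ ∫⁻ ω, ‖X ω - Xs ω‖ₑ ^ 2 ∂μ := by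
    intro t ht
    obtain ⟨u, hu, hue⟩ := (stronglyMeasurable_condExp (μ := μ) (f := fun ω => X ω - Xs ω)
      (m := MeasurableSpace.comap (fun ω => t • X ω + (1 - t) • Xs ω)
        inferInstance)).exists_eq_measurable_comp
    have hvu : ∀ᵐ z ∂(μ.map (fun ω => t • X ω + (1 - t) • Xs ω)), v z t = u z := by
      refine ae_map_of_ae_comp μ _ (hZt t) _ ?_
      filter_upwards [hv t] with ω hω
      rw [hω, hue]; rfl
    have hvu' := hvu
    rw [← hmarg t ht] at hvu'
    have hum : Measurable (fun z => ‖u z‖ₑ ^ 2) := hu.measurable.enorm.pow_const 2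
    calc ∫⁻ ω, ‖v (Zhat t ω) t‖ₑ ^ 2 ∂μ = ∫⁻ ω, ‖u (Zhat t ω)‖ₑ ^ 2 ∂μ := by
          refine lintegral_congr_ae ?_
          filter_upwards [ae_of_ae_map (hZm t ht) hvu'] with ω hω
          rw [hω]
      _ = ∫⁻ z, ‖u z‖ₑ ^ 2 ∂(μ.map (Zhat t)) :=
          (lintegral_map' hum.aemeasurable (hZm t ht)).symm
      _ = ∫⁻ ω, ‖u (t • X ω + (1 - t) • Xs ω)‖ₑ ^ 2 ∂μ := by
          rw [hmarg t ht, lintegral_map hum (hZt t)]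
      _ = eLpNorm (μ[(fun ω => X ω - Xs ω) |
          MeasurableSpace.comap (fun ω => t • X ω + (1 - t) • Xs ω) inferInstance]) 2 μ ^ 2 := by
          rw [sqe, hue]; rfl
      _ ≤ eLpNorm (fun ω => X ω - Xs ω) 2 μ ^ 2 := by
          gcongr
          exact eLpNorm_condExp_le_eLpNorm _ one_le_two
      _ = _ := sqe _
  have hjoint := aemeasurable_deriv_uncurry μ Zhat (fun t ω => v (Zhat t ω) t) hZm hode
  have main : ∫⁻ ω, ‖Zhat 1 ω - Xs ω‖ₑ ^ 2 ∂μ ≤ ∫⁻ ω, ‖X ω - Xs ω‖ₑ ^ 2 ∂μ := by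
    calc ∫⁻ ω, ‖Zhat 1 ω - Xs ω‖ₑ ^ 2 ∂μ
        ≤ ∫⁻ ω, (∫⁻ t in Set.Ioc (0:ℝ) 1, ‖v (Zhat t ω) t‖ₑ ^ 2) ∂μ := by
          refine lintegral_mono fun ω => ?_
          rw [← hinit]
          exact enorm_sub_sq_le (fun s => Zhat s ω) (fun t => v (Zhat t ω) t) (hode ω)
      _ = ∫⁻ t in Set.Ioc (0:ℝ) 1, (∫⁻ ω, ‖v (Zhat t ω) t‖ₑ ^ 2 ∂μ) :=
          lintegral_lintegral_swap (hjoint.enorm.pow_const 2)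
      _ ≤ ∫⁻ t in Set.Ioc (0:ℝ) 1, (∫⁻ ω, ‖X ω - Xs ω‖ₑ ^ 2 ∂μ) :=
          setLIntegral_mono measurable_const fun t ht => hvel t ⟨ht.1.le, ht.2⟩
      _ = _ := by simp
  have hconv : ∀ f : Ω → EuclideanSpace ℝ (Fin n), AEStronglyMeasurable f μ →
      ∫ ω, ‖f ω‖ ^ 2 ∂μ = (∫⁻ ω, ‖f ω‖ₑ ^ 2 ∂μ).toReal := by
    intro f hf
    have hm : AEStronglyMeasurable (fun ω => ‖f ω‖ ^ 2) μ := hf.norm.pow 2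
    rw [integral_eq_lintegral_of_nonneg_ae (Filter.Eventually.of_forall fun ω => by positivity)
      hm]
    congr 1
    refine lintegral_congr fun ω => ?_
    rw [ENNReal.ofReal_pow (norm_nonneg _), ofReal_norm]
  rw [hconv (fun ω => Zhat 1 ω - Xs ω)
    ((hZm 1 (by simp)).sub hXsm.aemeasurable).aestronglyMeasurable,
    hconv (fun ω => X ω - Xs ω) hD.1]
  refine ENNReal.toReal_mono ?_ main
  rw [← sqe (fun ω => X ω - Xs ω)]
  exact ENNReal.pow_ne_top hD.2.ne
end

section
/- Under the assumptions of Proposition 1, if additionally the conditional distribution of X − X̂* given Z_t = z_t is non-degenerate for almost every z_t in the support of p_{Z_t} and every t ∈ [0,1], then E[‖X − Ẑ_1‖²] < 2·E[‖X − X̂*‖²], i.e. the MSE of the PMRF output is strictly smaller than that of the posterior sampler. -/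
open MeasureTheory ProbabilityTheory


lemma aux_polish {Ω E : Type*} [MeasurableSpace Ω] [StandardBorelSpace Ω]
    [TopologicalSpace E] [SecondCountableTopology E] [MeasurableSpace E] [OpensMeasurableSpace E]
    (f : Ω → E) (hf : Measurable f) :
    ∃ t : TopologicalSpace Ω, PolishSpace Ω ∧ BorelSpace Ω ∧ Continuous f := by
  let u := upgradeStandardBorel Ω
  obtain ⟨t', t't, hc, hp⟩ := hf.exists_continuous
  refine ⟨t', hp, ?_, hc⟩
  constructor
  rw [eq_borel_upgradeStandardBorel Ω]
  exact (borel_eq_borel_of_le hp u.toPolishSpace t't).symm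

lemma aux_aemeasurable {Ω E G : Type*} [MeasurableSpace Ω] [StandardBorelSpace Ω]
    [TopologicalSpace E] [SecondCountableTopology E] [T2Space E] [MeasurableSpace E] [BorelSpace E]
    [TopologicalSpace G] [SecondCountableTopology G] [MeasurableSpace G] [BorelSpace G]
    [TopologicalSpace.PseudoMetrizableSpace G]
    (μ : Measure Ω) [IsFiniteMeasure μ] (f : Ω → E) (hf : Measurable f) (h : E → G)
    (hh : AEMeasurable (fun ω => h (f ω)) μ) : AEMeasurable h (μ.map f) := by
  obtain ⟨g, hg, hfg⟩ := hh
  obtain ⟨t', hp, hb, hc⟩ := aux_polish _ (hf.prodMk hg)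
  have hcf : Continuous f := continuous_fst.comp hc
  have hcg : Continuous g := continuous_snd.comp hc
  obtain ⟨M, hMsub, hM, hM0⟩ : ∃ M : Set Ω, (∀ ω ∈ M, h (f ω) = g ω) ∧ MeasurableSet M ∧
      μ M = μ Set.univ := by
    obtain ⟨T, h1, h2, h3⟩ := exists_measurable_superset_of_null (ae_iff.mp hfg)
    refine ⟨Tᶜ, fun ω hω => ?_, h2.compl, ?_⟩
    · by_contra hne
      exact hω (h1 hne)
    · rw [measure_compl h2 (measure_ne_top _ _), h3, tsub_zero]
  have hK : ∀ k : ℕ, ∃ K ⊆ M, IsCompact K ∧ μ M < μ K + ((k : ENNReal))⁻¹ := by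
    intro k
    exact hM.exists_isCompact_lt_add (measure_ne_top _ _) (by simp)
  choose K hKM hKc hKμ using hK
  have hmeas : ∀ k, MeasurableSet (f '' (K k)) := fun k =>
    ((hKc k).image hcf).isClosed.measurableSet
  have hS : ∀ᵐ z ∂(μ.map f), z ∈ ⋃ k, f '' (K k) := by
    have hms : MeasurableSet {z : E | z ∈ ⋃ k, f '' (K k)} := MeasurableSet.iUnion hmeas
    rw [ae_map_iff hf.aemeasurable hms]
    have hU : MeasurableSet (⋃ k, K k) := .iUnion fun k => (hKc k).isClosed.measurableSet
    have h1 : ∀ᵐ ω ∂μ, ω ∈ ⋃ k, K k := by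
      have : μ Set.univ ≤ μ (⋃ k, K k) := by
        have ht : Filter.Tendsto (fun k : ℕ => μ (⋃ k, K k) + ((k : ENNReal))⁻¹) Filter.atTop
            (nhds (μ (⋃ k, K k) + 0)) :=
          tendsto_const_nhds.add ENNReal.tendsto_inv_nat_nhds_zero
        rw [add_zero] at ht
        refine ge_of_tendsto' ht fun k => ?_
        rw [← hM0]
        refine (hKμ k).le.trans ?_
        gcongr
        exact Set.subset_iUnion K k
      rw [ae_iff]
      change μ (⋃ k, K k)ᶜ = 0
      rw [measure_compl hU (measure_ne_top _ _)]
      exact tsub_eq_zero_of_le this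
    filter_upwards [h1] with ω hω
    obtain ⟨k, hk⟩ := Set.mem_iUnion.mp hω
    exact Set.mem_iUnion.mpr ⟨k, ω, hk, rfl⟩
  rw [← Measure.restrict_eq_self_of_ae_mem hS, aemeasurable_iUnion_iff]
  intro k
  refine ContinuousOn.aemeasurable ?_ (hmeas k)
  rw [continuousOn_iff_isClosed]
  intro C hC
  refine ⟨f '' (K k ∩ g ⁻¹' C), ((hKc k).inter_right (hC.preimage hcg)).image hcf |>.isClosed, ?_⟩
  ext z
  constructor
  · rintro ⟨hz, ω, hω, rfl⟩
    exact ⟨⟨ω, ⟨hω, by simpa [← hMsub ω (hKM k hω)] using hz⟩, rfl⟩, ω, hω, rfl⟩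
  · rintro ⟨⟨ω, ⟨hω, hω2⟩, rfl⟩, h2⟩
    exact ⟨by simpa [hMsub ω (hKM k hω)] using hω2, h2⟩


/-- joint measurability of the time derivative -/
lemma aux_joint {Ω E : Type*} [MeasurableSpace Ω] [NormedAddCommGroup E] [NormedSpace ℝ E]
    [SecondCountableTopology E] [MeasurableSpace E] [BorelSpace E]
    (μ : Measure Ω) [IsFiniteMeasure μ] (Z V : ℝ → Ω → E)
    (hZ : ∀ t ∈ Set.Icc (0 : ℝ) 1, AEMeasurable (Z t) μ)
    (hd : ∀ ω, ∀ t ∈ Set.Icc (0 : ℝ) 1, HasDerivAt (fun s => Z s ω) (V t ω) t) :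
    AEMeasurable (Function.uncurry V) ((volume.restrict (Set.Ioo (0 : ℝ) 1)).prod μ) := by
  classical
  let τ : ℕ → ℝ → ℝ := fun k t => ((⌊(k + 1 : ℝ) * t⌋ : ℝ) + 1) / (k + 1)
  let G : ℝ → Ω → E := fun r => if h : r ∈ Set.Icc (0 : ℝ) 1 then (hZ r h).mk (Z r) else 0
  have hGm : ∀ r, Measurable (G r) := by
    intro r
    by_cases h : r ∈ Set.Icc (0 : ℝ) 1
    · simp only [G, dif_pos h]; exact (hZ r h).measurable_mk
    · simp only [G, dif_neg h]; exact measurable_const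
  have hGe : ∀ r ∈ Set.Icc (0 : ℝ) 1, ∀ᵐ ω ∂μ, Z r ω = G r ω := by
    intro r h
    simp only [G, dif_pos h]; exact (hZ r h).ae_eq_mk
  have hN : ∀ᵐ ω ∂μ, ∀ (k : ℕ) (j : ℤ), ((j : ℝ) + 1) / (k + 1) ∈ Set.Icc (0 : ℝ) 1 →
      Z (((j : ℝ) + 1) / (k + 1)) ω = G (((j : ℝ) + 1) / (k + 1)) ω := by
    rw [ae_all_iff]; intro k
    rw [ae_all_iff]; intro j
    by_cases h : ((j : ℝ) + 1) / (k + 1) ∈ Set.Icc (0 : ℝ) 1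
    · filter_upwards [hGe _ h] with ω hω _ using hω
    · exact ae_of_all _ fun ω h' => absurd h' h
  have hN' : ∀ᵐ p ∂((volume.restrict (Set.Ioo (0 : ℝ) 1)).prod μ), p.1 ∈ Set.Ioo (0 : ℝ) 1 ∧
      ∀ (k : ℕ) (j : ℤ), ((j : ℝ) + 1) / (k + 1) ∈ Set.Icc (0 : ℝ) 1 →
      Z (((j : ℝ) + 1) / (k + 1)) p.2 = G (((j : ℝ) + 1) / (k + 1)) p.2 := by
    have h1 : ∀ᵐ t ∂(volume.restrict (Set.Ioo (0 : ℝ) 1)), t ∈ Set.Ioo (0 : ℝ) 1 :=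
      ae_restrict_mem measurableSet_Ioo
    exact (Measure.quasiMeasurePreserving_fst.ae h1).and
      (Measure.quasiMeasurePreserving_snd.ae hN)
  have hAm : ∀ k, Measurable (fun p : ℝ × Ω => G (τ k p.1) p.2) := by
    intro k
    have h1 : Measurable (fun q : ℤ × Ω => G (((q.1 : ℝ) + 1) / (k + 1)) q.2) :=
      measurable_from_prod_countable_right fun j => hGm (((j : ℝ) + 1) / (k + 1))
    have h2 : Measurable (fun p : ℝ × Ω => (⌊(k + 1 : ℝ) * p.1⌋, p.2)) :=
      (Int.measurable_floor.comp (measurable_fst.const_mul _)).prodMk measurable_snd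
    exact h1.comp h2
  have hτm : ∀ k, Measurable (τ k) := by
    intro k
    have : Measurable (fun t : ℝ => ⌊(k + 1 : ℝ) * t⌋) :=
      Int.measurable_floor.comp (measurable_id.const_mul _)
    have h2 : Measurable (fun t : ℝ => ((⌊(k + 1 : ℝ) * t⌋ : ℤ) : ℝ)) :=
      (measurable_from_top (f := fun j : ℤ => (j : ℝ))).comp this
    exact (h2.add_const _).div_const _
  have hτgt : ∀ k t, t < τ k t := by
    intro k t
    have hk : (0 : ℝ) < k + 1 := by positivity
    rw [lt_div_iff₀ hk, mul_comm]
    exact Int.lt_floor_add_one _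
  have hτle : ∀ k t, τ k t ≤ t + 1 / ((k : ℝ) + 1) := by
    intro k t
    have hk : (0 : ℝ) < k + 1 := by positivity
    have h := Int.floor_le ((k + 1 : ℝ) * t)
    have h' : (t + 1 / ((k : ℝ) + 1)) * (k + 1) = (k + 1) * t + 1 := by field_simp
    rw [div_le_iff₀ hk, h']
    linarith
  have hτlim : ∀ t, Filter.Tendsto (fun k => τ k t) Filter.atTop (nhds t) := by
    intro t
    refine tendsto_of_tendsto_of_tendsto_of_le_of_le tendsto_const_nhds ?_
      (fun k => (hτgt k t).le) (fun k => hτle k t)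
    have h := (tendsto_const_nhds (x := t) (f := Filter.atTop (α := ℕ))).add
      (tendsto_one_div_add_atTop_nhds_zero_nat (𝕜 := ℝ))
    rwa [add_zero] at h
  have hAeq : ∀ p : ℝ × Ω, (p.1 ∈ Set.Ioo (0 : ℝ) 1 ∧
      ∀ (k : ℕ) (j : ℤ), ((j : ℝ) + 1) / (k + 1) ∈ Set.Icc (0 : ℝ) 1 →
      Z (((j : ℝ) + 1) / (k + 1)) p.2 = G (((j : ℝ) + 1) / (k + 1)) p.2) →
      ∀ᶠ k in Filter.atTop, Z (τ k p.1) p.2 = G (τ k p.1) p.2 := by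
    rintro p ⟨hp, hp2⟩
    filter_upwards [(hτlim p.1).eventually (Ioo_mem_nhds hp.1 hp.2)] with k hk
    exact hp2 k _ (Set.Ioo_subset_Icc_self hk)
  have hZm : AEMeasurable (Function.uncurry Z) ((volume.restrict (Set.Ioo (0 : ℝ) 1)).prod μ) := by
    refine aemeasurable_of_tendsto_metrizable_ae Filter.atTop
      (f := fun k (p : ℝ × Ω) => G (τ k p.1) p.2) (fun k => (hAm k).aemeasurable) ?_
    filter_upwards [hN'] with p hp
    refine Filter.Tendsto.congr' (hAeq p hp) ?_
    exact (hd p.2 p.1 (Set.Ioo_subset_Icc_self hp.1)).continuousAt.tendsto.comp (hτlim p.1)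
  refine aemeasurable_of_tendsto_metrizable_ae Filter.atTop
      (f := fun k (p : ℝ × Ω) => (τ k p.1 - p.1)⁻¹ • (G (τ k p.1) p.2 - Z p.1 p.2)) (fun k => ?_) ?_
  · exact ((((hτm k).comp measurable_fst).sub measurable_fst).inv.aemeasurable).smul
      ((hAm k).aemeasurable.sub hZm)
  · filter_upwards [hN'] with p hp
    have h1 := hasDerivAt_iff_tendsto_slope.mp (hd p.2 p.1 (Set.Ioo_subset_Icc_self hp.1))
    have h2 : Filter.Tendsto (fun k => τ k p.1) Filter.atTop (nhdsWithin p.1 {p.1}ᶜ) :=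
      tendsto_nhdsWithin_iff.mpr ⟨hτlim p.1, Filter.Eventually.of_forall fun k => (hτgt k _).ne'⟩
    refine Filter.Tendsto.congr' ?_ (h1.comp h2)
    filter_upwards [hAeq p hp] with k hk
    simp [slope, hk]

/-- FTC + Cauchy-Schwarz -/
lemma aux_ftc {E : Type*} [NormedAddCommGroup E] [NormedSpace ℝ E] [CompleteSpace E]
    [SecondCountableTopology E]  [MeasurableSpace E] [BorelSpace E]
    (f f' : ℝ → E) (hd : ∀ t ∈ Set.Icc (0 : ℝ) 1, HasDerivAt f (f' t) t) :
    ‖f 1 - f 0‖ₑ ^ 2 ≤ ∫⁻ t in Set.Ioo (0 : ℝ) 1, ‖f' t‖ₑ ^ 2 := by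
  by_cases htop : ∫⁻ t in Set.Ioo (0 : ℝ) 1, ‖f' t‖ₑ ^ 2 = ⊤
  · rw [htop]; exact le_top
  have hm : AEStronglyMeasurable f' (volume.restrict (Set.Ioo (0 : ℝ) 1)) := by
    refine ((measurable_deriv f).aemeasurable.congr ?_).aestronglyMeasurable
    filter_upwards [ae_restrict_mem measurableSet_Ioo] with t ht
    exact (hd t (Set.Ioo_subset_Icc_self ht)).deriv
  have : IsProbabilityMeasure (volume.restrict (Set.Ioo (0 : ℝ) 1)) := ⟨by simp⟩
  have h2 : eLpNorm f' 2 (volume.restrict (Set.Ioo (0 : ℝ) 1)) ^ 2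
      = ∫⁻ t in Set.Ioo (0 : ℝ) 1, ‖f' t‖ₑ ^ 2 := by
    simpa using eLpNorm_nnreal_pow_eq_lintegral (f := f') (p := 2)
      (μ := volume.restrict (Set.Ioo (0 : ℝ) 1)) (by norm_num)
  have h12 := eLpNorm_le_eLpNorm_of_exponent_le (p := 1) (q := 2) (by norm_num) hm
  have hmem : MemLp f' 2 (volume.restrict (Set.Ioo (0 : ℝ) 1)) := by
    refine ⟨hm, ?_⟩
    rw [lt_top_iff_ne_top]
    intro h
    rw [h] at h2
    exact htop (by rw [← h2]; simp)
  have hint : IntervalIntegrable f' volume 0 1 := by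
    rw [intervalIntegrable_iff_integrableOn_Ioo_of_le zero_le_one]
    exact hmem.integrable (by norm_num)
  have hftc := intervalIntegral.integral_eq_sub_of_hasDerivAt
    (fun t ht => hd t (by simpa using ht)) hint
  rw [← h2, ← hftc, intervalIntegral.integral_of_le zero_le_one, integral_Ioc_eq_integral_Ioo]
  gcongr
  refine (enorm_integral_le_lintegral_enorm _).trans ?_
  rwa [eLpNorm_one_eq_lintegral_enorm] at h12


lemma aux_lintegral {Ω E : Type*} [MeasurableSpace Ω] [NormedAddCommGroup E]
    (μ : Measure Ω) [IsFiniteMeasure μ] (f : Ω → E) (hf : MemLp f 2 μ) :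
    ∫⁻ ω, ‖f ω‖ₑ ^ 2 ∂μ = ENNReal.ofReal (∫ ω, ‖f ω‖ ^ 2 ∂μ) := by
  rw [ofReal_integral_eq_lintegral_ofReal hf.integrable_norm_pow' (ae_of_all _ fun ω => by positivity)]
  refine lintegral_congr fun ω => ?_
  rw [ENNReal.ofReal_pow (norm_nonneg _), ofReal_norm]

lemma aux_inner {Ω E : Type*} {m0 : MeasurableSpace Ω} [NormedAddCommGroup E]
    [InnerProductSpace ℝ E]
    (μ : Measure Ω) (D S : Ω → E) (hD : MemLp D 2 μ) (hS : MemLp S 2 μ) :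
    Integrable (fun ω => inner ℝ (S ω) (D ω)) μ := by
  refine Integrable.mono (hS.norm.integrable_mul hD.norm) (hS.1.inner hD.1) (ae_of_all _ fun ω => ?_)
  simpa using norm_inner_le_norm (𝕜 := ℝ) (S ω) (D ω)

lemma aux_orth {Ω E : Type*} {m m0 : MeasurableSpace Ω} [NormedAddCommGroup E]
    [InnerProductSpace ℝ E] [CompleteSpace E] (hm : m ≤ m0)
    (μ : Measure Ω) [IsFiniteMeasure μ] (D S : Ω → E) (hD : MemLp D 2 μ) (hS : MemLp S 2 μ)
    (hSm : AEStronglyMeasurable[m] S μ) :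
    ∫ ω, inner ℝ (S ω) (D ω) ∂μ = ∫ ω, inner ℝ (S ω) ((μ[D | m]) ω) ∂μ := by
  have hi : Integrable (fun ω => inner ℝ (S ω) (D ω)) μ := aux_inner μ D S hD hS
  have h := condExp_bilin_of_aestronglyMeasurable_left (innerSL ℝ) hSm (g := D) hi
    (hD.integrable (by norm_num))
  rw [← integral_condExp hm]
  exact integral_congr_ae h

lemma aux_expand {Ω E : Type*} {m0 : MeasurableSpace Ω} [NormedAddCommGroup E]
    [InnerProductSpace ℝ E]
    (μ : Measure Ω) [IsFiniteMeasure μ] (D S : Ω → E) (hD : MemLp D 2 μ) (hS : MemLp S 2 μ) :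
    ∫ ω, ‖D ω - S ω‖ ^ 2 ∂μ = ∫ ω, ‖D ω‖ ^ 2 ∂μ - 2 * ∫ ω, inner ℝ (S ω) (D ω) ∂μ
      + ∫ ω, ‖S ω‖ ^ 2 ∂μ := by
  have hi : Integrable (fun ω => inner ℝ (S ω) (D ω)) μ := aux_inner μ D S hD hS
  have h1 : Integrable (fun ω => ‖D ω‖ ^ 2) μ := hD.integrable_norm_pow'
  have h2 : Integrable (fun ω => ‖S ω‖ ^ 2) μ := hS.integrable_norm_pow'
  rw [← integral_const_mul, ← integral_sub h1 (hi.const_mul 2),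
    ← integral_add (f := fun ω => ‖D ω‖ ^ 2 - 2 * inner ℝ (S ω) (D ω)) (h1.sub (hi.const_mul 2)) h2]
  refine integral_congr_ae (ae_of_all _ fun ω => ?_)
  simp only [norm_sub_sq_real, real_inner_comm]

lemma aux_strict {Ω E : Type*} [MeasurableSpace Ω] [NormedAddCommGroup E]
    [InnerProductSpace ℝ E] [CompleteSpace E] [SecondCountableTopology E] [MeasurableSpace E]
    [BorelSpace E]
    (μ : Measure Ω) [IsProbabilityMeasure μ] (D Z : Ω → E) (hD : MemLp D 2 μ)
    (hZ : Measurable Z)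
    (hn : ∀ᵐ z ∂(μ.map Z), ∀ c : E, condDistrib D Z μ z ≠ Measure.dirac c) :
    ∫⁻ ω, ‖(μ[D | MeasurableSpace.comap Z inferInstance]) ω‖ₑ ^ 2 ∂μ < ∫⁻ ω, ‖D ω‖ₑ ^ 2 ∂μ := by
  have hm : MeasurableSpace.comap Z inferInstance ≤ ‹MeasurableSpace Ω› := hZ.comap_le
  set P := μ[D | MeasurableSpace.comap Z inferInstance] with hP
  have hP2 : MemLp P 2 μ := hD.condExp (by norm_num)
  have hPm : StronglyMeasurable[MeasurableSpace.comap Z inferInstance] P := stronglyMeasurable_condExp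
  have ho := aux_orth hm μ D P hD hP2 hPm.aestronglyMeasurable
  have he := aux_expand μ D P hD hP2
  rw [ho] at he
  simp only [← hP, real_inner_self_eq_norm_sq] at he
  rw [aux_lintegral μ P hP2, aux_lintegral μ D hD]
  by_contra hlt
  rw [ENNReal.ofReal_lt_ofReal_iff_of_nonneg (by positivity), not_lt] at hlt
  have h0 : ∫ ω, ‖D ω - P ω‖ ^ 2 ∂μ = 0 :=
    le_antisymm (by linarith) (by positivity)
  rw [integral_eq_zero_iff_of_nonneg (f := fun ω => ‖D ω - P ω‖ ^ 2) (fun ω => by positivity)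
    (hD.sub hP2).integrable_norm_pow'] at h0
  have hDP : D =ᵐ[μ] P := by
    filter_upwards [h0] with ω hω
    simpa [sub_eq_zero] using hω
  obtain ⟨g, hg, hgP⟩ := hPm.measurable.exists_eq_measurable_comp
  rw [hgP] at hDP
  have h1 := condDistrib_comp_self (μ := μ) Z hg
  rw [← condDistrib_congr_left hDP] at h1
  have : IsProbabilityMeasure (μ.map Z) := Measure.isProbabilityMeasure_map hZ.aemeasurable
  obtain ⟨z, hz1, hz2⟩ := (hn.and h1).exists
  exact hz1 (g z) (by rw [hz2, Kernel.deterministic_apply])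

/-- Proposition 1(c): under the PMRF assumptions, if additionally the conditional
distribution of `X − X̂*` given `Z_t` is non-degenerate a.e. for every `t ∈ [0,1]`, then
`E‖X − Ẑ_1‖² < 2·E‖X − X̂*‖²`: PMRF strictly beats the posterior sampler in MSE. -/
theorem pmrf_strictly_beats_posterior_sampler
    {Ω : Type*} [MeasurableSpace Ω] [StandardBorelSpace Ω]
    (μ : Measure Ω) [IsProbabilityMeasure μ] {n m : ℕ}
    (X : Ω → EuclideanSpace ℝ (Fin n)) (Y : Ω → EuclideanSpace ℝ (Fin m))
    (hX : Measurable X) (hY : Measurable Y)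
    (hX2 : Integrable (fun ω => ‖X ω‖ ^ 2) μ)
    (Xs : Ω → EuclideanSpace ℝ (Fin n))
    (hXs : Xs = μ[X | MeasurableSpace.comap Y inferInstance])
    (v : EuclideanSpace ℝ (Fin n) → ℝ → EuclideanSpace ℝ (Fin n))
    (hv : ∀ t : ℝ,
      (fun ω => v (t • X ω + (1 - t) • Xs ω) t)
        =ᵐ[μ] μ[(fun ω => X ω - Xs ω) |
          MeasurableSpace.comap (fun ω => t • X ω + (1 - t) • Xs ω) inferInstance])
    (Zhat : ℝ → Ω → EuclideanSpace ℝ (Fin n))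
    (hinit : Zhat 0 = Xs)
    (hode : ∀ ω, ∀ t ∈ Set.Icc (0 : ℝ) 1,
      HasDerivAt (fun s => Zhat s ω) (v (Zhat t ω) t) t)
    (huniq : ∀ Z' : ℝ → Ω → EuclideanSpace ℝ (Fin n), Z' 0 = Xs →
      (∀ ω, ∀ t ∈ Set.Icc (0 : ℝ) 1,
        HasDerivAt (fun s => Z' s ω) (v (Z' t ω) t) t) →
      ∀ t ∈ Set.Icc (0 : ℝ) 1, ∀ ω, Z' t ω = Zhat t ω)
    (hmarg : ∀ t ∈ Set.Icc (0 : ℝ) 1,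
      Measure.map (Zhat t) μ = Measure.map (fun ω => t • X ω + (1 - t) • Xs ω) μ)
    (hnondeg : ∀ t ∈ Set.Icc (0 : ℝ) 1,
      ∀ᵐ z ∂(Measure.map (fun ω => t • X ω + (1 - t) • Xs ω) μ),
        ∀ c : EuclideanSpace ℝ (Fin n),
          condDistrib (fun ω => X ω - Xs ω) (fun ω => t • X ω + (1 - t) • Xs ω) μ z
            ≠ Measure.dirac c) :
    ∫ ω, ‖X ω - Zhat 1 ω‖ ^ 2 ∂μ < 2 * ∫ ω, ‖X ω - Xs ω‖ ^ 2 ∂μ := by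
  have hmY : MeasurableSpace.comap Y inferInstance ≤ ‹MeasurableSpace Ω› := hY.comap_le
  have hXL : MemLp X 2 μ :=
    (memLp_two_iff_integrable_sq_norm hX.aestronglyMeasurable).mpr hX2
  have hXsS : StronglyMeasurable[MeasurableSpace.comap Y inferInstance] Xs := by
    rw [hXs]; exact stronglyMeasurable_condExp
  have hXsm : Measurable Xs := (hXsS.mono hmY).measurable
  have hXsL : MemLp Xs 2 μ := by rw [hXs]; exact hXL.condExp (by norm_num)
  have hDL : MemLp (fun ω => X ω - Xs ω) 2 μ := hXL.sub hXsL
  have hZm : ∀ t : ℝ, Measurable (fun ω => t • X ω + (1 - t) • Xs ω) := fun t =>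
    (hX.const_smul t).add (hXsm.const_smul (1 - t))
  -- the flow is a.e.-measurable
  have hZh : ∀ t ∈ Set.Icc (0 : ℝ) 1, AEMeasurable (Zhat t) μ := by
    intro t ht
    by_contra hna
    have h := hmarg t ht
    rw [Measure.map_of_not_aemeasurable hna] at h
    have hp : IsProbabilityMeasure (μ.map (fun ω => t • X ω + (1 - t) • Xs ω)) :=
      Measure.isProbabilityMeasure_map (hZm t).aemeasurable
    rw [← h] at hp
    have h01 := hp.measure_univ
    rw [Measure.coe_zero, Pi.zero_apply] at h01
    exact zero_ne_one h01
  -- second moment of the velocity along the flow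
  have hvel : ∀ t ∈ Set.Icc (0 : ℝ) 1,
      ∫⁻ ω, ‖v (Zhat t ω) t‖ₑ ^ 2 ∂μ < ∫⁻ ω, ‖X ω - Xs ω‖ₑ ^ 2 ∂μ := by
    intro t ht
    have hcond : AEMeasurable (fun ω => v (t • X ω + (1 - t) • Xs ω) t) μ :=
      ((stronglyMeasurable_condExp.mono (hZm t).comap_le).measurable.aemeasurable).congr
        (hv t).symm
    have hvm := aux_aemeasurable μ _ (hZm t) (fun z => v z t) hcond
    have hvm' : AEMeasurable (fun z => v z t) (μ.map (Zhat t)) := by rw [hmarg t ht]; exact hvm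
    have e1 := lintegral_map' (hvm.enorm.pow_const 2) (hZm t).aemeasurable
    have e2 := lintegral_map' (hvm'.enorm.pow_const 2) (hZh t ht)
    rw [hmarg t ht, e1] at e2
    rw [← e2]
    refine lt_of_eq_of_lt ?_ (aux_strict μ (fun ω => X ω - Xs ω) _ hDL (hZm t) (hnondeg t ht))
    refine lintegral_congr_ae ?_
    filter_upwards [hv t] with ω hω
    rw [hω]
  -- the displacement
  have hW : ∫⁻ ω, ‖Zhat 1 ω - Xs ω‖ₑ ^ 2 ∂μ < ∫⁻ ω, ‖X ω - Xs ω‖ₑ ^ 2 ∂μ := by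
    have hj := aux_joint μ Zhat (fun t ω => v (Zhat t ω) t) hZh hode
    have hfin : ∫⁻ ω, ‖X ω - Xs ω‖ₑ ^ 2 ∂μ ≠ ⊤ := by
      rw [aux_lintegral μ _ hDL]; exact ENNReal.ofReal_ne_top
    have hae : ∀ᵐ t ∂(volume.restrict (Set.Ioo (0 : ℝ) 1)),
        ∫⁻ ω, ‖v (Zhat t ω) t‖ₑ ^ 2 ∂μ < ∫⁻ ω, ‖X ω - Xs ω‖ₑ ^ 2 ∂μ := by
      filter_upwards [ae_restrict_mem measurableSet_Ioo] with t ht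
      exact hvel t (Set.Ioo_subset_Icc_self ht)
    have hc : ∫⁻ _t in Set.Ioo (0 : ℝ) 1, (∫⁻ ω, ‖X ω - Xs ω‖ₑ ^ 2 ∂μ)
        = ∫⁻ ω, ‖X ω - Xs ω‖ₑ ^ 2 ∂μ := by simp
    calc ∫⁻ ω, ‖Zhat 1 ω - Xs ω‖ₑ ^ 2 ∂μ
        ≤ ∫⁻ ω, (∫⁻ t in Set.Ioo (0 : ℝ) 1, ‖v (Zhat t ω) t‖ₑ ^ 2) ∂μ := by
          refine lintegral_mono fun ω => ?_
          have h := aux_ftc (fun s => Zhat s ω) (fun t => v (Zhat t ω) t) (hode ω)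
          simpa only [hinit] using h
      _ = ∫⁻ t in Set.Ioo (0 : ℝ) 1, ∫⁻ ω, ‖v (Zhat t ω) t‖ₑ ^ 2 ∂μ :=
          (lintegral_lintegral_swap (hj.enorm.pow_const 2)).symm
      _ < ∫⁻ _t in Set.Ioo (0 : ℝ) 1, (∫⁻ ω, ‖X ω - Xs ω‖ₑ ^ 2 ∂μ) := by
          refine lintegral_strict_mono ?_ aemeasurable_const ?_ hae
          · simp
          · refine ne_top_of_le_ne_top hfin ?_
            rw [← hc]
            exact lintegral_mono_ae (hae.mono fun _ h => h.le)
      _ = _ := hc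
  -- the flow endpoint is a function of `Xs`
  have hfac : Function.FactorsThrough (Zhat 1) Xs := by
    classical
    intro ω₁ ω₂ h12
    have h := huniq (fun t ω => if ω = ω₂ then Zhat t ω₁ else Zhat t ω) ?_ ?_ 1 (by simp) ω₂
    · simpa using h
    · funext ω
      by_cases hω : ω = ω₂
      · simp [hω, hinit, h12]
      · simp [hω, hinit]
    · intro ω t ht
      by_cases hω : ω = ω₂
      · simpa [hω] using hode ω₁ t ht
      · simpa [hω] using hode ω t ht
  have hF : AEStronglyMeasurable[MeasurableSpace.comap Y inferInstance] (Zhat 1) μ := by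
    have hFc : ∀ ω, Function.extend Xs (Zhat 1) 0 (Xs ω) = Zhat 1 ω :=
      fun ω => hfac.extend_apply 0 ω
    have hFm : AEMeasurable (Function.extend Xs (Zhat 1) 0) (μ.map Xs) := by
      refine aux_aemeasurable μ Xs hXsm _ ?_
      simp only [hFc]
      exact hZh 1 (by simp)
    refine ⟨fun ω => hFm.mk _ (Xs ω), ?_, ?_⟩
    · exact (hFm.measurable_mk.comp hXsS.measurable).stronglyMeasurable
    · filter_upwards [ae_of_ae_map hXsm.aemeasurable hFm.ae_eq_mk] with ω hω
      rw [← hω, hFc]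
  have hWm : AEStronglyMeasurable[MeasurableSpace.comap Y inferInstance]
      (fun ω => Zhat 1 ω - Xs ω) μ := hF.sub hXsS.aestronglyMeasurable
  have hZ1L : MemLp (Zhat 1) 2 μ := by
    have h1 := hmarg 1 (by simp)
    simp only [one_smul, sub_self, zero_smul, add_zero] at h1
    have hid : MemLp id 2 (μ.map (Zhat 1)) := by
      rw [h1]
      exact (memLp_map_measure_iff aestronglyMeasurable_id hX.aemeasurable).mpr hXL
    exact (memLp_map_measure_iff aestronglyMeasurable_id (hZh 1 (by simp))).mp hid
  have hWL : MemLp (fun ω => Zhat 1 ω - Xs ω) 2 μ := hZ1L.sub hXsL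
  have horth : ∫ ω, inner ℝ (Zhat 1 ω - Xs ω) (X ω - Xs ω) ∂μ = 0 := by
    have h := aux_orth hmY μ X (fun ω => Zhat 1 ω - Xs ω) hXL hWL hWm
    rw [← hXs] at h
    simp only [inner_sub_right]
    rw [integral_sub (aux_inner μ _ _ hXL hWL) (aux_inner μ _ _ hXsL hWL), h, sub_self]
  have he := aux_expand μ (fun ω => X ω - Xs ω) (fun ω => Zhat 1 ω - Xs ω) hDL hWL
  simp only [sub_sub_sub_cancel_right, horth] at he
  rw [aux_lintegral μ _ hWL, aux_lintegral μ _ hDL,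
    ENNReal.ofReal_lt_ofReal_iff_of_nonneg (by positivity)] at hW
  rw [he]
  linarith
end
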